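/- Let K be a Hermitian H-operator-valued kernel on X. The following are equivalent: (1) there exists a positive semidefinite kernel L with −L ≤ K ≤ L; (1′) there exists a positive semidefinite kernel L with K ≤ L; (2) there exists a positive semidefinite kernel L such that |[f,g]_K| ≤ ⟨f,f⟩_L^{1/2} ⟨g,g⟩_L^{1/2} for all f, g ∈ F⁰(X;H); (3) K = K₁ − K₂ for some positive semidefinite kernels K₁, K₂; (3′) K = K₁ − K₂ for some disjoint positive semidefinite kernels K₁, K₂; (4) there exists a Krein space linearisation of K. Moreover, if any of these conditions holds, then a minimal Krein space linearisation of K exists. -/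

import Mathlib

open scoped InnerProductSpace

noncomputable section

universe u v w w'

variable {𝕜 : Type u} [RCLike 𝕜] {X : Type v} {H : X → Type w}
  [∀ x, NormedAddCommGroup (H x)] [∀ x, InnerProductSpace 𝕜 (H x)]
  [∀ x, CompleteSpace (H x)]

/-- `K` is a Hermitian `H`-operator valued kernel: `K(x,y)* = K(y,x)`.
Here `K y x : H x →L[𝕜] H y` is the operator `K(y,x)`. -/
def IsHermitianK (K : ∀ y x : X, H x →L[𝕜] H y) : Prop :=
  ∀ x y : X, ContinuousLinearMap.adjoint (K x y) = K y x

/-- `K` is a positive semidefinite kernel. -/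
def IsPSDK (K : ∀ y x : X, H x →L[𝕜] H y) : Prop :=
  IsHermitianK K ∧ ∀ (n : ℕ) (x : Fin n → X) (h : ∀ i, H (x i)),
    0 ≤ RCLike.re (∑ i, ∑ j, ⟪K (x j) (x i) (h i), h j⟫_𝕜)

/-- The order on Hermitian kernels: `K ≤ L` iff `L - K` is positive
semidefinite. -/
def KLE (K L : ∀ y x : X, H x →L[𝕜] H y) : Prop :=
  IsPSDK (fun y x => L y x - K y x)

/-- Two positive semidefinite kernels are disjoint if the only positive
semidefinite kernel dominated by both is zero. -/
def DisjointK (K₁ K₂ : ∀ y x : X, H x →L[𝕜] H y) : Prop :=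
  ∀ P : ∀ y x : X, H x →L[𝕜] H y,
    IsPSDK P → KLE P K₁ → KLE P K₂ → ∀ y x : X, P y x = 0

/-- A bundled Krein space over `𝕜`: a Hilbert space together with a
fundamental symmetry `J` (`J* = J`, `J² = I`); the indefinite inner product is
`[h, k] = ⟪J h, k⟫`. -/
structure KSp (𝕜 : Type u) [RCLike 𝕜] : Type (max u (w' + 1)) where
  carrier : Type w'
  [ng : NormedAddCommGroup carrier]
  [ip : InnerProductSpace 𝕜 carrier]
  [cs : CompleteSpace carrier]
  J : carrier →L[𝕜] carrier
  J_adj : ContinuousLinearMap.adjoint J = J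
  J_sq : J.comp J = ContinuousLinearMap.id 𝕜 carrier

attribute [instance] KSp.ng KSp.ip KSp.cs

/-- `(𝒦, J, V)` is a Krein space linearisation of `K`:
`K(x,y) = V(x)* J V(y)`. -/
def IsKreinLin (K : ∀ y x : X, H x →L[𝕜] H y) (𝒦 : KSp.{u, w'} 𝕜)
    (V : ∀ x : X, H x →L[𝕜] 𝒦.carrier) : Prop :=
  ∀ x y : X, K x y = (ContinuousLinearMap.adjoint (V x)).comp (𝒦.J.comp (V y))

/-- Minimality of a Krein space linearisation. -/
def IsMinimalKLin (𝒦 : KSp.{u, w'} 𝕜) (V : ∀ x : X, H x →L[𝕜] 𝒦.carrier) :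
    Prop :=
  Dense (↑(Submodule.span 𝕜 (⋃ x : X, Set.range (V x))) : Set 𝒦.carrier)

section KernelForm

variable {E : Type*} [NormedAddCommGroup E] [InnerProductSpace 𝕜 E] [CompleteSpace E]

/-- The form of a factorised kernel `K(y,x) = V(y)* A V(x)` is the form of `A` on the range of the
linear extension of `V`. -/
theorem sum_sum_inner_eq_inner_of_factorisation {K : ∀ y x : X, H x →L[𝕜] H y} {A : E →L[𝕜] E}
    {V : ∀ x : X, H x →L[𝕜] E} (hV : ∀ y x, K y x = (V y).adjoint.comp (A.comp (V x)))
    {n m : ℕ} (x : Fin n → X) (y : Fin m → X) (f : ∀ i, H (x i)) (g : ∀ j, H (y j)) :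
    ∑ i, ∑ j, ⟪K (y j) (x i) (f i), g j⟫_𝕜 =
      ⟪A (∑ i, V (x i) (f i)), ∑ j, V (y j) (g j)⟫_𝕜 := by
  rw [map_sum, sum_inner]
  simp [hV, inner_sum, ContinuousLinearMap.adjoint_inner_left]

/-- The form of a kernel with a Hilbert space factorisation is an inner product. -/
theorem sum_sum_inner_eq_inner {K : ∀ y x : X, H x →L[𝕜] H y}
    {V : ∀ x : X, H x →L[𝕜] E} (hV : ∀ y x, K y x = (V y).adjoint.comp (V x))
    {n m : ℕ} (x : Fin n → X) (y : Fin m → X) (f : ∀ i, H (x i)) (g : ∀ j, H (y j)) :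
    ∑ i, ∑ j, ⟪K (y j) (x i) (f i), g j⟫_𝕜 =
      ⟪∑ i, V (x i) (f i), ∑ j, V (y j) (g j)⟫_𝕜 := by
  rw [sum_inner]
  simp [hV, inner_sum, ContinuousLinearMap.adjoint_inner_left]

theorem isHermitianK_of_factorisation {K : ∀ y x : X, H x →L[𝕜] H y}
    {V : ∀ x : X, H x →L[𝕜] E} (hV : ∀ y x, K y x = (V y).adjoint.comp (V x)) :
    IsHermitianK K := fun x y => by
  rw [hV, hV, ContinuousLinearMap.adjoint_comp, ContinuousLinearMap.adjoint_adjoint]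

theorem isPSDK_of_factorisation {K : ∀ y x : X, H x →L[𝕜] H y}
    {V : ∀ x : X, H x →L[𝕜] E} (hV : ∀ y x, K y x = (V y).adjoint.comp (V x)) :
    IsPSDK K := by
  refine ⟨isHermitianK_of_factorisation hV, fun n x h => ?_⟩
  rw [sum_sum_inner_eq_inner hV]
  exact inner_self_nonneg

end KernelForm

theorem IsHermitianK.add {K L : ∀ y x : X, H x →L[𝕜] H y} (hK : IsHermitianK K)
    (hL : IsHermitianK L) : IsHermitianK (fun y x => K y x + L y x) := fun x y => by
  rw [map_add, hK x y, hL x y]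

theorem IsHermitianK.sub {K L : ∀ y x : X, H x →L[𝕜] H y} (hK : IsHermitianK K)
    (hL : IsHermitianK L) : IsHermitianK (fun y x => K y x - L y x) := fun x y => by
  rw [map_sub, hK x y, hL x y]

theorem IsPSDK.add {K L : ∀ y x : X, H x →L[𝕜] H y} (hK : IsPSDK K) (hL : IsPSDK L) :
    IsPSDK (fun y x => K y x + L y x) := by
  refine ⟨hK.1.add hL.1, fun n x h => ?_⟩
  have := add_nonneg (hK.2 n x h) (hL.2 n x h)
  simpa only [add_apply, inner_add_left, Finset.sum_add_distrib, map_add]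

theorem isPSDK_zero : IsPSDK (fun y x : X => (0 : H x →L[𝕜] H y)) :=
  ⟨fun x y => map_zero _, fun n x h => by simp⟩

theorem KLE.trans {K L M : ∀ y x : X, H x →L[𝕜] H y} (hKL : KLE K L) (hLM : KLE L M) :
    KLE K M := by
  have := IsPSDK.add hLM hKL
  simp only [sub_add_sub_cancel] at this
  exact this

section Kolmogorov

set_option linter.unusedSectionVars false

open scoped Classical in
/-- The sesquilinear form of the kernel `L` on finitely supported sections. -/
def kernelForm (L : ∀ y x : X, H x →L[𝕜] H y) (f g : Π₀ x, H x) : 𝕜 :=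
  DFinsupp.lsum ℕ (fun y =>
    (innerSL 𝕜 (DFinsupp.lsum ℕ (fun x => (L y x).toLinearMap) f)).toLinearMap) g

open scoped Classical in
theorem kernelForm_eq_sum (L : ∀ y x : X, H x →L[𝕜] H y) (f g : Π₀ x, H x) :
    kernelForm L f g = ∑ x ∈ f.support, ∑ y ∈ g.support, ⟪L y x (f x), g y⟫_𝕜 := by
  rw [Finset.sum_comm]
  simp [kernelForm, DFinsupp.sumAddHom_apply, DFinsupp.sum]

open scoped Classical in
theorem kernelForm_single (L : ∀ y x : X, H x →L[𝕜] H y) {x y : X} (h : H x) (k : H y) :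
    kernelForm L (DFinsupp.single x h) (DFinsupp.single y k) = ⟪L y x h, k⟫_𝕜 := by
  simp [kernelForm]

theorem kernelForm_add_left (L : ∀ y x : X, H x →L[𝕜] H y) (f f' g : Π₀ x, H x) :
    kernelForm L (f + f') g = kernelForm L f g + kernelForm L f' g := by
  classical
  unfold kernelForm
  simp only [map_add]
  simp [DFinsupp.sumAddHom_apply, DFinsupp.sum, Finset.sum_add_distrib]

theorem kernelForm_smul_left (L : ∀ y x : X, H x →L[𝕜] H y) (c : 𝕜) (f g : Π₀ x, H x) :
    kernelForm L (c • f) g = starRingEnd 𝕜 c * kernelForm L f g := by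
  classical
  unfold kernelForm
  simp only [map_smul]
  simp [DFinsupp.sumAddHom_apply, DFinsupp.sum, Finset.mul_sum]

theorem IsHermitianK.conj_kernelForm {L : ∀ y x : X, H x →L[𝕜] H y} (hL : IsHermitianK L)
    (f g : Π₀ x, H x) : starRingEnd 𝕜 (kernelForm L g f) = kernelForm L f g := by
  rw [kernelForm_eq_sum, kernelForm_eq_sum, Finset.sum_comm]
  simp only [map_sum, inner_conj_symm]
  refine Finset.sum_congr rfl fun x _ => Finset.sum_congr rfl fun y _ => ?_
  rw [← hL y x, ContinuousLinearMap.adjoint_inner_right]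

theorem IsPSDK.kernelForm_self_nonneg {L : ∀ y x : X, H x →L[𝕜] H y} (hL : IsPSDK L)
    (f : Π₀ x, H x) : 0 ≤ RCLike.re (kernelForm L f f) := by
  classical
  let e := f.support.equivFin.symm
  have := hL.2 _ (fun i => (e i : X)) (fun i => f (e i))
  rw [kernelForm_eq_sum, ← Finset.sum_coe_sort, ← Equiv.sum_comp e]
  simp_rw [← Finset.sum_coe_sort f.support, ← Equiv.sum_comp e]
  exact this

/-- The semi-inner product on finitely supported sections defined by a positive semidefinite
kernel. -/
abbrev IsPSDK.core {L : ∀ y x : X, H x →L[𝕜] H y} (hL : IsPSDK L) :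
    PreInnerProductSpace.Core 𝕜 (Π₀ x, H x) where
  inner := kernelForm L
  conj_inner_symm := hL.1.conj_kernelForm
  re_inner_nonneg := hL.kernelForm_self_nonneg
  add_left := kernelForm_add_left L
  smul_left f g c := kernelForm_smul_left L c f g

/-- Every positive semidefinite kernel has a minimal Hilbert space linearisation. -/
theorem IsPSDK.exists_factorisation {L : ∀ y x : X, H x →L[𝕜] H y} (hL : IsPSDK L) :
    ∃ (E : Type max v w) (_ : NormedAddCommGroup E) (_ : InnerProductSpace 𝕜 E)
      (_ : CompleteSpace E) (V : ∀ x : X, H x →L[𝕜] E),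
      (∀ y x, L y x = (V y).adjoint.comp (V x)) ∧
      Dense (↑(Submodule.span 𝕜 (⋃ x : X, Set.range (V x))) : Set E) := by
  classical
  let : PreInnerProductSpace.Core 𝕜 (Π₀ x, H x) := hL.core
  let : SeminormedAddCommGroup (Π₀ x, H x) :=
    InnerProductSpace.Core.toSeminormedAddCommGroup (𝕜 := 𝕜)
  let : InnerProductSpace 𝕜 (Π₀ x, H x) := .ofCore _
  have inner_single {x y : X} (h : H x) (k : H y) :
      ⟪DFinsupp.single x h, DFinsupp.single y k⟫_𝕜 = ⟪L y x h, k⟫_𝕜 := kernelForm_single L h k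
  have bound (x : X) (h : H x) : ‖DFinsupp.single x h‖ ≤ √‖L x x‖ * ‖h‖ := by
    refine le_of_sq_le_sq ?_ (by positivity)
    rw [mul_pow, Real.sq_sqrt (norm_nonneg _), ← inner_self_eq_norm_sq (𝕜 := 𝕜), inner_single]
    calc RCLike.re ⟪L x x h, h⟫_𝕜 ≤ ‖L x x h‖ * ‖h‖ := re_inner_le_norm _ _
      _ ≤ ‖L x x‖ * ‖h‖ * ‖h‖ := by gcongr; exact (L x x).le_opNorm h
      _ = ‖L x x‖ * ‖h‖ ^ 2 := by ring
  let V (x : X) : H x →L[𝕜] UniformSpace.Completion (Π₀ x, H x) :=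
    (UniformSpace.Completion.toComplL (𝕜 := 𝕜)).comp
      ((DFinsupp.lsingle x : H x →ₗ[𝕜] Π₀ x, H x).mkContinuous (√‖L x x‖) (bound x))
  have hV (x : X) (h : H x) : V x h = ((DFinsupp.single x h : Π₀ x, H x) :
      UniformSpace.Completion (Π₀ x, H x)) := rfl
  refine ⟨UniformSpace.Completion (Π₀ x, H x), inferInstance, inferInstance, inferInstance, V,
    fun y x => ?_, ?_⟩
  · ext h
    refine ext_inner_right 𝕜 fun k => ?_
    rw [ContinuousLinearMap.comp_apply, ContinuousLinearMap.adjoint_inner_left, hV, hV,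
      UniformSpace.Completion.inner_coe, inner_single]
  · refine UniformSpace.Completion.denseRange_coe.mono ?_
    rintro _ ⟨f, rfl⟩
    induction f using DFinsupp.induction with
    | h0 => exact Submodule.zero_mem _
    | ha x h f _ _ ih =>
      rw [UniformSpace.Completion.coe_add]
      exact Submodule.add_mem _ (Submodule.subset_span (Set.mem_iUnion.2 ⟨x, h, hV x h⟩)) ih

end Kolmogorov

theorem IsPSDK.re_inner_nonneg {L : ∀ y x : X, H x →L[𝕜] H y} (hL : IsPSDK L) {x : X} (h : H x) :
    0 ≤ RCLike.re ⟪L x x h, h⟫_𝕜 := by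
  simpa using hL.2 1 (fun _ => x) (fun _ => h)

theorem KLE.re_inner_le {K L : ∀ y x : X, H x →L[𝕜] H y} (hKL : KLE K L) {x : X} (h : H x) :
    RCLike.re ⟪K x x h, h⟫_𝕜 ≤ RCLike.re ⟪L x x h, h⟫_𝕜 := by
  simpa [inner_sub_left] using IsPSDK.re_inner_nonneg hKL h

/-- A positive semidefinite kernel dominated by `K` is bounded in terms of the diagonal of `K`. -/
theorem IsPSDK.norm_le_of_kle {P K : ∀ y x : X, H x →L[𝕜] H y} (hP : IsPSDK P) (hPK : KLE P K)
    (y x : X) : ‖P y x‖ ≤ √‖K y y‖ * √‖K x x‖ := by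
  obtain ⟨E, _, _, _, V, hV, -⟩ := hP.exists_factorisation
  have bound (x : X) : ‖V x‖ ≤ √‖K x x‖ := by
    refine ContinuousLinearMap.opNorm_le_bound _ (Real.sqrt_nonneg _) fun h => ?_
    refine le_of_sq_le_sq ?_ (by positivity)
    have hle := hPK.re_inner_le h
    rw [hV, ContinuousLinearMap.comp_apply, ContinuousLinearMap.adjoint_inner_left,
      inner_self_eq_norm_sq] at hle
    rw [mul_pow, Real.sq_sqrt (norm_nonneg _)]
    calc ‖V x h‖ ^ 2 ≤ ‖K x x h‖ * ‖h‖ := hle.trans (re_inner_le_norm _ _)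
      _ ≤ ‖K x x‖ * ‖h‖ * ‖h‖ := by gcongr; exact (K x x).le_opNorm h
      _ = ‖K x x‖ * ‖h‖ ^ 2 := by ring
  rw [hV]
  refine (ContinuousLinearMap.opNorm_comp_le _ _).trans ?_
  rw [LinearIsometryEquiv.norm_map]
  gcongr
  exacts [bound y, bound x]

/-- A positive semidefinite kernel with vanishing diagonal vanishes. -/
theorem IsPSDK.eq_zero_of_re_inner_nonpos {P : ∀ y x : X, H x →L[𝕜] H y} (hP : IsPSDK P)
    (h0 : ∀ (x : X) (h : H x), RCLike.re ⟪P x x h, h⟫_𝕜 ≤ 0) (y x : X) : P y x = 0 := by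
  obtain ⟨E, _, _, _, V, hV, -⟩ := hP.exists_factorisation
  have hVx : V x = 0 := by
    ext h
    have := h0 x h
    rw [hV, ContinuousLinearMap.comp_apply, ContinuousLinearMap.adjoint_inner_left,
      inner_self_eq_norm_sq] at this
    simpa using this
  rw [hV, hVx, ContinuousLinearMap.comp_zero]

section WeakLimits

open Filter Topology

/-- Norm bounded families of operators between Hilbert spaces converge weakly along ultrafilters. -/
theorem exists_tendsto_inner_of_norm_le {ι E F : Type*} [NormedAddCommGroup E]
    [InnerProductSpace 𝕜 E] [NormedAddCommGroup F] [InnerProductSpace 𝕜 F] [CompleteSpace F]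
    (U : Ultrafilter ι) (T : ι → E →L[𝕜] F) {C : ℝ} (hT : ∀ i, ‖T i‖ ≤ C) :
    ∃ S : E →L[𝕜] F, ∀ h k, Tendsto (fun i => ⟪T i h, k⟫_𝕜) U (𝓝 ⟪S h, k⟫_𝕜) := by
  have bound (i : ι) (h : E) : ‖T i h‖ ≤ C * ‖h‖ := (T i).le_of_opNorm_le (hT i) h
  have weak (h : E) : ∃ v : F, ‖v‖ ≤ C * ‖h‖ ∧
      ∀ k, Tendsto (fun i => ⟪T i h, k⟫_𝕜) U (𝓝 ⟪v, k⟫_𝕜) := by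
    have compact := WeakDual.isCompact_closedBall (0 : StrongDual 𝕜 F) (C * ‖h‖)
    obtain ⟨φ, hφ, hlim⟩ := compact.ultrafilter_le_nhds
      (U.map fun i => StrongDual.toWeakDual (InnerProductSpace.toDual 𝕜 F (T i h)))
      (le_principal_iff.2 <| Filter.mem_map.2 <| univ_mem' fun i => by simpa using bound i h)
    refine ⟨(InnerProductSpace.toDual 𝕜 F).symm (WeakDual.toStrongDual φ), by simpa using hφ,
      fun k => ?_⟩
    have := ((WeakDual.eval_continuous k).tendsto φ).comp (show Tendsto _ _ _ from hlim)
    simpa [Function.comp_def] using this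
  choose S hS hlim using weak
  let S' : E →ₗ[𝕜] F :=
    { toFun := S
      map_add' := fun a b => ext_inner_right 𝕜 fun k => by
        refine tendsto_nhds_unique (hlim (a + b) k) ?_
        simpa [inner_add_left] using (hlim a k).add (hlim b k)
      map_smul' := fun c a => ext_inner_right 𝕜 fun k => by
        refine tendsto_nhds_unique (hlim (c • a) k) ?_
        simpa [inner_smul_left] using (hlim a k).const_mul (starRingEnd 𝕜 c) }
  exact ⟨S'.mkContinuous C hS, hlim⟩

theorem IsPSDK.of_tendsto {ι : Type*} {l : Filter ι} [l.NeBot]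
    {P : ι → ∀ y x : X, H x →L[𝕜] H y} {Q : ∀ y x : X, H x →L[𝕜] H y}
    (hP : ∀ᶠ i in l, IsPSDK (P i))
    (hlim : ∀ y x h k, Tendsto (fun i => ⟪P i y x h, k⟫_𝕜) l (𝓝 ⟪Q y x h, k⟫_𝕜)) :
    IsPSDK Q := by
  refine ⟨fun x y => ?_, fun n x h => ?_⟩
  · ext h
    refine ext_inner_right 𝕜 fun k => ?_
    rw [ContinuousLinearMap.adjoint_inner_left, ← inner_conj_symm]
    refine tendsto_nhds_unique_of_eventuallyEq
      ((RCLike.continuous_conj.tendsto _).comp (hlim x y k h)) (hlim y x h k) ?_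
    filter_upwards [hP] with i hi
    rw [Function.comp_apply, inner_conj_symm, ← hi.1 x y, ContinuousLinearMap.adjoint_inner_left]
  · refine ge_of_tendsto ((RCLike.continuous_re.tendsto _).comp
      (tendsto_finsetSum _ fun i _ => tendsto_finsetSum _ fun j _ => hlim _ _ _ _)) ?_
    filter_upwards [hP] with i hi using hi.2 n x h

/-- A chain of positive semidefinite kernels dominated by `K₁` and `K₂` has an upper bound among
such kernels. -/
theorem exists_upper_bound_of_isChain {K₁ K₂ : ∀ y x : X, H x →L[𝕜] H y} (hK₁ : IsPSDK K₁)
    (hK₂ : IsPSDK K₂) {c : Set {P : ∀ y x : X, H x →L[𝕜] H y // IsPSDK P ∧ KLE P K₁ ∧ KLE P K₂}}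
    (hc : IsChain (fun P Q => KLE P.1 Q.1) c) :
    ∃ Q : {P : ∀ y x : X, H x →L[𝕜] H y // IsPSDK P ∧ KLE P K₁ ∧ KLE P K₂},
      ∀ P ∈ c, KLE P.1 Q.1 := by
  rcases c.eq_empty_or_nonempty with rfl | hne
  · exact ⟨⟨_, isPSDK_zero, by simpa [KLE] using hK₁, by simpa [KLE] using hK₂⟩, by simp⟩
  have refl (P : ∀ y x : X, H x →L[𝕜] H y) : KLE P P := by simpa [KLE] using isPSDK_zero
  have := hne.to_subtype
  have directed : Directed (· ≥ ·) fun P : c => 𝓟 {Q : c | KLE P.1.1 Q.1.1} := by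
    intro P Q
    obtain ⟨R, hPR, hQR⟩ : ∃ R : c, KLE P.1.1 R.1.1 ∧ KLE Q.1.1 R.1.1 := by
      by_cases hPQ : P.1 = Q.1
      · exact ⟨Q, hPQ ▸ refl _, refl _⟩
      · rcases hc P.2 Q.2 hPQ with h | h
        exacts [⟨Q, h, refl _⟩, ⟨P, refl _, h⟩]
    exact ⟨R, principal_mono.2 fun _ h => hPR.trans h, principal_mono.2 fun _ h => hQR.trans h⟩
  have : (⨅ P : c, 𝓟 {Q : c | KLE P.1.1 Q.1.1}).NeBot :=
    iInf_neBot_of_directed' directed fun P => principal_neBot_iff.2 ⟨P, refl _⟩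
  let U := Ultrafilter.of (⨅ P : c, 𝓟 {Q : c | KLE P.1.1 Q.1.1})
  have hU (P : c) : ∀ᶠ Q : c in U, KLE P.1.1 Q.1.1 :=
    Ultrafilter.of_le _ (mem_iInf_of_mem P (mem_principal_self _))
  choose Q hQ using fun y x => exists_tendsto_inner_of_norm_le U (fun P : c => P.1.1 y x)
    (fun P => P.1.2.1.norm_le_of_kle P.1.2.2.1 y x)
  have le_of_forall {K : ∀ y x : X, H x →L[𝕜] H y} (hK : ∀ P : c, KLE P.1.1 K) : KLE Q K := by
    refine IsPSDK.of_tendsto (l := U) (.of_forall hK) fun y x h k => ?_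
    simpa [inner_sub_left] using (hQ y x h k).const_sub ⟪K y x h, k⟫_𝕜
  refine ⟨⟨Q, .of_tendsto (.of_forall fun P : c => P.1.2.1) hQ,
    le_of_forall fun P => P.1.2.2.1, le_of_forall fun P => P.1.2.2.2⟩, fun P hP => ?_⟩
  refine IsPSDK.of_tendsto (P := fun R : c => fun y x => R.1.1 y x - P.1 y x) (hU ⟨P, hP⟩)
    fun y x h k => ?_
  simpa [inner_sub_left] using (hQ y x h k).sub_const ⟪P.1 y x h, k⟫_𝕜

end WeakLimits

/-- Subtracting a maximal common minorant makes two positive semidefinite kernels disjoint. -/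
theorem exists_disjointK_sub {K₁ K₂ : ∀ y x : X, H x →L[𝕜] H y} (hK₁ : IsPSDK K₁)
    (hK₂ : IsPSDK K₂) : ∃ P : ∀ y x : X, H x →L[𝕜] H y, KLE P K₁ ∧ KLE P K₂ ∧
      DisjointK (fun y x => K₁ y x - P y x) (fun y x => K₂ y x - P y x) := by
  obtain ⟨⟨P, hP, hP₁, hP₂⟩, hmax⟩ := exists_maximal_of_chains_bounded
    (fun c hc => exists_upper_bound_of_isChain hK₁ hK₂ hc) (fun h h' => h.trans h')
  refine ⟨P, hP₁, hP₂, fun Q hQ hQ₁ hQ₂ => hQ.eq_zero_of_re_inner_nonpos fun x h => ?_⟩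
  have := hmax ⟨fun y x => P y x + Q y x, hP.add hQ, by simpa only [KLE, sub_sub] using hQ₁,
    by simpa only [KLE, sub_sub] using hQ₂⟩ (by simpa [KLE] using hQ)
  simpa [inner_add_left] using this.re_inner_le h

section DirectSum

set_option linter.unusedSectionVars false in
theorem dense_span_iff_forall_inner_eq_zero {E : Type*} [NormedAddCommGroup E]
    [InnerProductSpace 𝕜 E] [CompleteSpace E] (V : ∀ x : X, H x →L[𝕜] E) :
    Dense (↑(Submodule.span 𝕜 (⋃ x : X, Set.range (V x))) : Set E) ↔
      ∀ e, (∀ x h, ⟪V x h, e⟫_𝕜 = 0) → e = 0 := by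
  rw [Submodule.dense_iff_topologicalClosure_eq_top, Submodule.topologicalClosure_eq_top_iff,
    Submodule.eq_bot_iff]
  refine forall_congr' fun e => imp_congr_left ?_
  rw [Submodule.mem_orthogonal]
  refine ⟨fun h x k => h _ (Submodule.subset_span (Set.mem_iUnion.2 ⟨x, k, rfl⟩)), fun h u hu => ?_⟩
  induction hu using Submodule.span_induction with
  | mem u hu =>
    obtain ⟨x, k, rfl⟩ := Set.mem_iUnion.1 hu
    exact h x k
  | zero => exact inner_zero_left _
  | add u v _ _ hu hv => rw [inner_add_left, hu, hv, add_zero]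
  | smul c u _ hu => rw [inner_smul_left, hu, mul_zero]

/-- Compressing a factorisation by a contraction yields a dominated kernel. -/
theorem kle_of_factorisation_comp {E F : Type*} [NormedAddCommGroup E] [InnerProductSpace 𝕜 E]
    [CompleteSpace E] [NormedAddCommGroup F] [InnerProductSpace 𝕜 F] [CompleteSpace F]
    {P K : ∀ y x : X, H x →L[𝕜] H y} {V : ∀ x : X, H x →L[𝕜] E} {W : ∀ x : X, H x →L[𝕜] F}
    (hV : ∀ y x, K y x = (V y).adjoint.comp (V x)) (hW : ∀ y x, P y x = (W y).adjoint.comp (W x))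
    {T : E →L[𝕜] F} (hT : ‖T‖ ≤ 1) (hWV : ∀ x h, W x h = T (V x h)) : KLE P K := by
  refine ⟨(isHermitianK_of_factorisation hV).sub (isHermitianK_of_factorisation hW),
    fun n x h => ?_⟩
  simp only [sub_apply, inner_sub_left, Finset.sum_sub_distrib, map_sub]
  rw [sum_sum_inner_eq_inner hV, sum_sum_inner_eq_inner hW, inner_self_eq_norm_sq,
    inner_self_eq_norm_sq, sub_nonneg]
  simp_rw [hWV, ← map_sum]
  gcongr
  exact T.le_of_opNorm_le_of_le hT le_rfl |>.trans_eq (one_mul _)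

/-- Minimal factorisations of disjoint kernels have a minimal direct sum. -/
theorem DisjointK.eq_zero_of_inner_add_inner_eq_zero {E₁ E₂ : Type*} [NormedAddCommGroup E₁]
    [InnerProductSpace 𝕜 E₁] [CompleteSpace E₁] [NormedAddCommGroup E₂] [InnerProductSpace 𝕜 E₂]
    [CompleteSpace E₂] {K₁ K₂ : ∀ y x : X, H x →L[𝕜] H y} (hK : DisjointK K₁ K₂)
    {V₁ : ∀ x : X, H x →L[𝕜] E₁} {V₂ : ∀ x : X, H x →L[𝕜] E₂}
    (hV₁ : ∀ y x, K₁ y x = (V₁ y).adjoint.comp (V₁ x))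
    (hV₂ : ∀ y x, K₂ y x = (V₂ y).adjoint.comp (V₂ x)) {e₁ : E₁} {e₂ : E₂}
    (he : ∀ x h, ⟪e₁, V₁ x h⟫_𝕜 + ⟪e₂, V₂ x h⟫_𝕜 = 0) (x : X) (h : H x) :
    ⟪e₁, V₁ x h⟫_𝕜 = 0 := by
  set c : ℝ := (1 + ‖e₁‖ + ‖e₂‖)⁻¹ with hc
  have hpos : 0 < 1 + ‖e₁‖ + ‖e₂‖ := by positivity
  have hc0 : 0 < c := inv_pos.2 hpos
  let T₁ : E₁ →L[𝕜] 𝕜 := (c : 𝕜) • innerSL 𝕜 e₁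
  let T₂ : E₂ →L[𝕜] 𝕜 := -((c : 𝕜) • innerSL 𝕜 e₂)
  have hT₁ : ‖T₁‖ ≤ 1 := by
    rw [norm_smul, innerSL_apply_norm, RCLike.norm_ofReal, abs_of_pos hc0, hc,
      inv_mul_le_one₀ hpos]
    linarith [norm_nonneg e₂]
  have hT₂ : ‖T₂‖ ≤ 1 := by
    rw [norm_neg, norm_smul, innerSL_apply_norm, RCLike.norm_ofReal, abs_of_pos hc0, hc,
      inv_mul_le_one₀ hpos]
    linarith [norm_nonneg e₁]
  let W (x : X) : H x →L[𝕜] 𝕜 := T₁.comp (V₁ x)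
  have hW (x : X) (h : H x) : W x h = T₂ (V₂ x h) := by
    simp [W, T₁, T₂, eq_neg_of_add_eq_zero_left (he x h)]
  have hzero := hK (fun y x => (W y).adjoint.comp (W x)) (isPSDK_of_factorisation fun _ _ => rfl)
    (kle_of_factorisation_comp hV₁ (fun _ _ => rfl) hT₁ fun _ _ => rfl)
    (kle_of_factorisation_comp hV₂ (fun _ _ => rfl) hT₂ hW) x x
  have hWx : W x h = 0 := by
    rw [← inner_self_eq_zero (𝕜 := 𝕜), ← ContinuousLinearMap.adjoint_inner_left,
      ← ContinuousLinearMap.comp_apply, hzero, zero_apply, inner_zero_left]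
  simpa [W, T₁, hc0.ne'] using hWx

/-- The fundamental symmetry `I ⊕ -I` of the Hilbert space direct sum `E₁ ⊕ E₂`. -/
def prodSymmetry (𝕜 : Type u) [RCLike 𝕜] (E₁ E₂ : Type*) [NormedAddCommGroup E₁]
    [InnerProductSpace 𝕜 E₁] [NormedAddCommGroup E₂] [InnerProductSpace 𝕜 E₂] :
    WithLp 2 (E₁ × E₂) →L[𝕜] WithLp 2 (E₁ × E₂) :=
  ((WithLp.prodContinuousLinearEquiv 2 𝕜 E₁ E₂).symm : E₁ × E₂ →L[𝕜] WithLp 2 (E₁ × E₂)).comp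
    (((ContinuousLinearMap.id 𝕜 E₁).prodMap (-ContinuousLinearMap.id 𝕜 E₂)).comp
      (WithLp.prodContinuousLinearEquiv 2 𝕜 E₁ E₂ : WithLp 2 (E₁ × E₂) →L[𝕜] E₁ × E₂))

theorem prodSymmetry_apply {E₁ E₂ : Type*} [NormedAddCommGroup E₁] [InnerProductSpace 𝕜 E₁]
    [NormedAddCommGroup E₂] [InnerProductSpace 𝕜 E₂] (a : WithLp 2 (E₁ × E₂)) :
    prodSymmetry 𝕜 E₁ E₂ a = WithLp.toLp 2 (a.fst, -a.snd) := rfl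

/-- The Krein space `E₁ ⊕ E₂` with fundamental symmetry `I ⊕ -I`. -/
def KSp.directSum (𝕜 : Type u) [RCLike 𝕜] (E₁ E₂ : Type w') [NormedAddCommGroup E₁]
    [InnerProductSpace 𝕜 E₁] [CompleteSpace E₁] [NormedAddCommGroup E₂] [InnerProductSpace 𝕜 E₂]
    [CompleteSpace E₂] : KSp.{u, w'} 𝕜 where
  carrier := WithLp 2 (E₁ × E₂)
  J := prodSymmetry 𝕜 E₁ E₂
  J_adj := by
    symm
    rw [ContinuousLinearMap.eq_adjoint_iff]
    intro a b
    simp [WithLp.prod_inner_apply, prodSymmetry_apply]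
  J_sq := by
    ext a
    exact WithLp.ofLp_injective 2 (Prod.ext rfl (neg_neg a.snd))

/-- A difference of disjoint positive semidefinite kernels has a minimal Krein space
linearisation. -/
theorem DisjointK.exists_minimal_linearisation {K K₁ K₂ : ∀ y x : X, H x →L[𝕜] H y}
    (hK₁ : IsPSDK K₁) (hK₂ : IsPSDK K₂) (hdisj : DisjointK K₁ K₂)
    (hK : ∀ y x, K y x = K₁ y x - K₂ y x) :
    ∃ (𝒦 : KSp.{u, max v w} 𝕜) (V : ∀ x : X, H x →L[𝕜] 𝒦.carrier),
      IsKreinLin K 𝒦 V ∧ IsMinimalKLin 𝒦 V := by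
  obtain ⟨E₁, _, _, _, V₁, hV₁, hd₁⟩ := hK₁.exists_factorisation
  obtain ⟨E₂, _, _, _, V₂, hV₂, hd₂⟩ := hK₂.exists_factorisation
  rw [dense_span_iff_forall_inner_eq_zero] at hd₁ hd₂
  let V (x : X) : H x →L[𝕜] WithLp 2 (E₁ × E₂) :=
    ((WithLp.prodContinuousLinearEquiv 2 𝕜 E₁ E₂).symm :
      E₁ × E₂ →L[𝕜] WithLp 2 (E₁ × E₂)).comp ((V₁ x).prod (V₂ x))
  have hV (x y : X) : K x y = (V x).adjoint.comp ((prodSymmetry 𝕜 E₁ E₂).comp (V y)) := by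
    ext h
    refine ext_inner_right 𝕜 fun k => ?_
    rw [ContinuousLinearMap.comp_apply, ContinuousLinearMap.adjoint_inner_left, hK, hV₁, hV₂]
    rw [sub_apply, inner_sub_left, sub_eq_add_neg]
    simp [prodSymmetry_apply, V, WithLp.prod_inner_apply, ContinuousLinearMap.adjoint_inner_left]
  refine ⟨KSp.directSum 𝕜 E₁ E₂, V, hV, ?_⟩
  refine (dense_span_iff_forall_inner_eq_zero (E := WithLp 2 (E₁ × E₂)) V).2 fun e he => ?_
  have hsum (x : X) (h : H x) : ⟪e.fst, V₁ x h⟫_𝕜 + ⟪e.snd, V₂ x h⟫_𝕜 = 0 := by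
    rw [← inner_conj_symm, ← inner_conj_symm e.snd, ← map_add, map_eq_zero]
    simpa [V, WithLp.prod_inner_apply] using he x h
  have h₁ := hdisj.eq_zero_of_inner_add_inner_eq_zero hV₁ hV₂ hsum
  have e₁ : e.fst = 0 := hd₁ _ fun x h => inner_eq_zero_symm.1 (h₁ x h)
  have e₂ : e.snd = 0 := hd₂ _ fun x h => inner_eq_zero_symm.1 <| by
    simpa [h₁ x h] using hsum x h
  exact WithLp.ofLp_injective 2 (Prod.ext e₁ e₂)

end DirectSum

section Equivalences

variable {K : ∀ y x : X, H x →L[𝕜] H y}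

/-- A difference of positive semidefinite kernels lies between `-L` and `L` for `L` their sum. -/
theorem exists_kle_of_eq_sub {K₁ K₂ : ∀ y x : X, H x →L[𝕜] H y} (hK₁ : IsPSDK K₁)
    (hK₂ : IsPSDK K₂) (hK : ∀ y x, K y x = K₁ y x - K₂ y x) :
    ∃ L : ∀ y x : X, H x →L[𝕜] H y, IsPSDK L ∧ KLE (fun y x => -(L y x)) K ∧ KLE K L := by
  refine ⟨_, hK₁.add hK₂, ?_, ?_⟩
  · rw [KLE]
    convert hK₁.add hK₁ using 3
    rw [hK]
    abel
  · rw [KLE]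
    convert hK₂.add hK₂ using 3
    rw [hK]
    abel

/-- A kernel dominated by a positive semidefinite kernel is a difference of disjoint positive
semidefinite kernels. -/
theorem exists_disjointK_of_kle {L : ∀ y x : X, H x →L[𝕜] H y} (hL : IsPSDK L) (hKL : KLE K L) :
    ∃ K₁ K₂ : ∀ y x : X, H x →L[𝕜] H y, IsPSDK K₁ ∧ IsPSDK K₂ ∧ DisjointK K₁ K₂ ∧
      ∀ y x, K y x = K₁ y x - K₂ y x := by
  obtain ⟨P, h₁, h₂, hdisj⟩ := exists_disjointK_sub hL hKL
  exact ⟨_, _, h₁, h₂, hdisj, fun y x => by rw [sub_sub_sub_cancel_right, sub_sub_cancel]⟩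

/-- A difference of positive semidefinite kernels satisfies the Schwarz inequality with respect to
their sum. -/
theorem norm_sum_sum_inner_le_of_eq_sub {K₁ K₂ : ∀ y x : X, H x →L[𝕜] H y} (hK₁ : IsPSDK K₁)
    (hK₂ : IsPSDK K₂) (hK : ∀ y x, K y x = K₁ y x - K₂ y x) {n m : ℕ} (x : Fin n → X)
    (y : Fin m → X) (f : ∀ i, H (x i)) (g : ∀ j, H (y j)) :
    ‖∑ i, ∑ j, ⟪K (y j) (x i) (f i), g j⟫_𝕜‖ ≤
      √(RCLike.re (∑ i, ∑ i', ⟪(K₁ (x i') (x i) + K₂ (x i') (x i)) (f i), f i'⟫_𝕜)) *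
      √(RCLike.re (∑ j, ∑ j', ⟪(K₁ (y j') (y j) + K₂ (y j') (y j)) (g j), g j'⟫_𝕜)) := by
  obtain ⟨E₁, _, _, _, V₁, hV₁, -⟩ := hK₁.exists_factorisation
  obtain ⟨E₂, _, _, _, V₂, hV₂, -⟩ := hK₂.exists_factorisation
  simp only [hK, add_apply, sub_apply, inner_add_left, inner_sub_left, Finset.sum_add_distrib,
    Finset.sum_sub_distrib, map_add]
  simp only [sum_sum_inner_eq_inner hV₁, sum_sum_inner_eq_inner hV₂, inner_self_eq_norm_sq]
  set a := ∑ i, V₁ (x i) (f i)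
  set b := ∑ i, V₂ (x i) (f i)
  set c := ∑ j, V₁ (y j) (g j)
  set d := ∑ j, V₂ (y j) (g j)
  calc ‖⟪a, c⟫_𝕜 - ⟪b, d⟫_𝕜‖ ≤ ‖a‖ * ‖c‖ + ‖b‖ * ‖d‖ :=
        (norm_sub_le _ _).trans (add_le_add (norm_inner_le_norm _ _) (norm_inner_le_norm _ _))
    _ ≤ √(‖a‖ ^ 2 + ‖b‖ ^ 2) * √(‖c‖ ^ 2 + ‖d‖ ^ 2) := by
        rw [← Real.sqrt_mul (by positivity)]
        refine Real.le_sqrt_of_sq_le ?_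
        nlinarith [sq_nonneg (‖a‖ * ‖d‖ - ‖b‖ * ‖c‖)]

/-- A Hermitian kernel whose quadratic form is dominated in modulus by that of `L` lies between
`-L` and `L`. -/
theorem IsHermitianK.kle_of_abs_re_le {L : ∀ y x : X, H x →L[𝕜] H y} (hK : IsHermitianK K)
    (hL : IsPSDK L) (h : ∀ (n : ℕ) (x : Fin n → X) (f : ∀ i, H (x i)),
      |RCLike.re (∑ i, ∑ j, ⟪K (x j) (x i) (f i), f j⟫_𝕜)| ≤
        RCLike.re (∑ i, ∑ j, ⟪L (x j) (x i) (f i), f j⟫_𝕜)) :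
    KLE (fun y x => -(L y x)) K ∧ KLE K L := by
  refine ⟨⟨by simpa only [sub_neg_eq_add] using hK.add hL.1, fun n x f => ?_⟩,
    ⟨hL.1.sub hK, fun n x f => ?_⟩⟩
  · have := neg_le_of_abs_le (h n x f)
    simp only [sub_neg_eq_add, add_apply, inner_add_left, Finset.sum_add_distrib, map_add]
    linarith
  · have := le_of_abs_le (h n x f)
    simp only [sub_apply, inner_sub_left, Finset.sum_sub_distrib, map_sub]
    linarith

theorem KSp.norm_J_apply (𝒦 : KSp.{u, w'} 𝕜) (a : 𝒦.carrier) : ‖𝒦.J a‖ = ‖a‖ := by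
  rw [← sq_eq_sq₀ (norm_nonneg _) (norm_nonneg _), ← inner_self_eq_norm_sq (𝕜 := 𝕜),
    ← inner_self_eq_norm_sq (𝕜 := 𝕜) a, ← ContinuousLinearMap.adjoint_inner_left, 𝒦.J_adj,
    ← ContinuousLinearMap.comp_apply, 𝒦.J_sq, ContinuousLinearMap.id_apply]

/-- A Hermitian kernel with a Krein space linearisation `(𝒦, J, V)` lies between `-V*V` and
`V*V`. -/
theorem IsKreinLin.exists_kle (hK : IsHermitianK K) {𝒦 : KSp.{u, w'} 𝕜}
    {V : ∀ x : X, H x →L[𝕜] 𝒦.carrier} (hV : IsKreinLin K 𝒦 V) :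
    ∃ L : ∀ y x : X, H x →L[𝕜] H y, IsPSDK L ∧ KLE (fun y x => -(L y x)) K ∧ KLE K L := by
  have hL : IsPSDK fun y x => (V y).adjoint.comp (V x) := isPSDK_of_factorisation fun _ _ => rfl
  refine ⟨_, hL, hK.kle_of_abs_re_le hL fun n x f => ?_⟩
  rw [sum_sum_inner_eq_inner_of_factorisation hV, sum_sum_inner_eq_inner fun _ _ => rfl,
    inner_self_eq_norm_sq]
  calc _ ≤ ‖𝒦.J (∑ i, V (x i) (f i))‖ * ‖∑ i, V (x i) (f i)‖ :=
        (RCLike.abs_re_le_norm _).trans (norm_inner_le_norm _ _)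
    _ = ‖∑ i, V (x i) (f i)‖ ^ 2 := by rw [𝒦.norm_J_apply, sq]

end Equivalences

/-- for a Hermitian kernel `K` the following are equivalent:
(1) `-L ≤ K ≤ L` for some positive semidefinite `L`;
(1′) `K ≤ L` for some positive semidefinite `L`;
(2) the Schwarz-type inequality
`|[f,g]_K| ≤ ⟨f,f⟩_L^{1/2}⟨g,g⟩_L^{1/2}` holds for some positive semidefinite
`L` (stated for finite families of points and vectors);
(3) `K = K₁ - K₂` with `K₁, K₂` positive semidefinite;
(3′) `K = K₁ - K₂` with `K₁, K₂` positive semidefinite and disjoint;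
(4) `K` has a Krein space linearisation.
Moreover, in that case `K` has a minimal Krein space linearisation. -/
theorem hermitian_kernel_krein_linearisation_tfae
    (K : ∀ y x : X, H x →L[𝕜] H y) (hK : IsHermitianK K) :
    ((∃ L : ∀ y x : X, H x →L[𝕜] H y, IsPSDK L ∧
        KLE (fun y x => -(L y x)) K ∧ KLE K L) ↔
      (∃ L : ∀ y x : X, H x →L[𝕜] H y, IsPSDK L ∧ KLE K L)) ∧
    ((∃ L : ∀ y x : X, H x →L[𝕜] H y, IsPSDK L ∧
        KLE (fun y x => -(L y x)) K ∧ KLE K L) ↔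
      (∃ L : ∀ y x : X, H x →L[𝕜] H y, IsPSDK L ∧
        ∀ (n m : ℕ) (x : Fin n → X) (y : Fin m → X)
          (f : ∀ i, H (x i)) (g : ∀ j, H (y j)),
          ‖∑ i, ∑ j, ⟪K (y j) (x i) (f i), g j⟫_𝕜‖ ≤
            Real.sqrt (RCLike.re (∑ i, ∑ i', ⟪L (x i') (x i) (f i), f i'⟫_𝕜)) *
            Real.sqrt
              (RCLike.re (∑ j, ∑ j', ⟪L (y j') (y j) (g j), g j'⟫_𝕜)))) ∧
    ((∃ L : ∀ y x : X, H x →L[𝕜] H y, IsPSDK L ∧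
        KLE (fun y x => -(L y x)) K ∧ KLE K L) ↔
      (∃ K₁ K₂ : ∀ y x : X, H x →L[𝕜] H y, IsPSDK K₁ ∧ IsPSDK K₂ ∧
        ∀ y x : X, K y x = K₁ y x - K₂ y x)) ∧
    ((∃ L : ∀ y x : X, H x →L[𝕜] H y, IsPSDK L ∧
        KLE (fun y x => -(L y x)) K ∧ KLE K L) ↔
      (∃ K₁ K₂ : ∀ y x : X, H x →L[𝕜] H y, IsPSDK K₁ ∧ IsPSDK K₂ ∧
        DisjointK K₁ K₂ ∧ ∀ y x : X, K y x = K₁ y x - K₂ y x)) ∧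
    ((∃ L : ∀ y x : X, H x →L[𝕜] H y, IsPSDK L ∧
        KLE (fun y x => -(L y x)) K ∧ KLE K L) ↔
      (∃ (𝒦 : KSp.{u, max v w} 𝕜) (V : ∀ x : X, H x →L[𝕜] 𝒦.carrier),
        IsKreinLin K 𝒦 V)) ∧
    ((∃ L : ∀ y x : X, H x →L[𝕜] H y, IsPSDK L ∧
        KLE (fun y x => -(L y x)) K ∧ KLE K L) →
      (∃ (𝒦 : KSp.{u, max v w} 𝕜) (V : ∀ x : X, H x →L[𝕜] 𝒦.carrier),
        IsKreinLin K 𝒦 V ∧ IsMinimalKLin 𝒦 V)) := by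
  refine ⟨⟨fun ⟨L, hL, _, hKL⟩ => ⟨L, hL, hKL⟩, fun ⟨L, hL, hKL⟩ =>
      exists_kle_of_eq_sub hL hKL fun _ _ => (sub_sub_cancel _ _).symm⟩,
    ⟨fun ⟨L, hL, _, hKL⟩ => ?_, fun ⟨L, hL, hKL⟩ => ?_⟩,
    ⟨fun ⟨L, hL, _, hKL⟩ => ⟨_, _, hL, hKL, fun _ _ => (sub_sub_cancel _ _).symm⟩,
      fun ⟨K₁, K₂, hK₁, hK₂, h⟩ => exists_kle_of_eq_sub hK₁ hK₂ h⟩,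
    ⟨fun ⟨L, hL, _, hKL⟩ => exists_disjointK_of_kle hL hKL,
      fun ⟨K₁, K₂, hK₁, hK₂, _, h⟩ => exists_kle_of_eq_sub hK₁ hK₂ h⟩,
    ⟨fun ⟨L, hL, _, hKL⟩ => ?_, fun ⟨𝒦, V, hV⟩ => hV.exists_kle hK⟩,
    fun ⟨L, hL, _, hKL⟩ => ?_⟩
  · exact ⟨_, hL.add hKL, fun n m x y f g =>
      norm_sum_sum_inner_le_of_eq_sub hL hKL (fun _ _ => (sub_sub_cancel _ _).symm) x y f g⟩
  · refine ⟨L, hL, hK.kle_of_abs_re_le hL fun n x f => ?_⟩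
    refine (RCLike.abs_re_le_norm _).trans ((hKL n n x x f f).trans_eq ?_)
    exact Real.mul_self_sqrt (hL.2 n x f)
  · obtain ⟨K₁, K₂, hK₁, hK₂, hdisj, h⟩ := exists_disjointK_of_kle hL hKL
    obtain ⟨𝒦, V, hV, -⟩ := hdisj.exists_minimal_linearisation hK₁ hK₂ h
    exact ⟨𝒦, V, hV⟩
  · obtain ⟨K₁, K₂, hK₁, hK₂, hdisj, h⟩ := exists_disjointK_of_kle hL hKL
    exact hdisj.exists_minimal_linearisation hK₁ hK₂ h
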